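/- For any matrices A, B, C in SU(2), with trace coordinates a = tr(A), b = tr(B), c = tr(C), x = tr(AB), y = tr(BC), z = tr(CA), d = tr(ABC), one has tr(A²B²C²) = abcd - bcy - acz - abx + a² + b² + c² - 2. -/

import Mathlib

open Matrix

/-- The Cayley-Hamilton theorem for `2 × 2` matrices of determinant one. -/
theorem Matrix.sq_eq_trace_smul_sub_one {R : Type*} [CommRing R]
    {M : Matrix (Fin 2) (Fin 2) R} (hM : M.det = 1) : M ^ 2 = M.trace • M - 1 := by
  rw [det_fin_two] at hM
  ext i j
  fin_cases i <;> fin_cases j <;>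
    simp [pow_two, mul_apply, trace_fin_two] <;> grind

/-- For `A, B, C ∈ SU(2)` with trace coordinates `a, b, c, x, y, z, d`,
`tr(A²B²C²) = abcd - bcy - acz - abx + a² + b² + c² - 2`. -/
theorem su2_trace_A2B2C2
    (A B C : Matrix (Fin 2) (Fin 2) ℂ)
    (hA : A ∈ Matrix.specialUnitaryGroup (Fin 2) ℂ)
    (hB : B ∈ Matrix.specialUnitaryGroup (Fin 2) ℂ)
    (hC : C ∈ Matrix.specialUnitaryGroup (Fin 2) ℂ)
    (a b c x y z d : ℂ)
    (ha : a = A.trace) (hb : b = B.trace) (hc : c = C.trace)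
    (hx : x = (A * B).trace) (hy : y = (B * C).trace) (hz : z = (C * A).trace)
    (hd : d = (A * B * C).trace) :
    (A ^ 2 * B ^ 2 * C ^ 2).trace =
      a * b * c * d - b * c * y - a * c * z - a * b * x
        + a ^ 2 + b ^ 2 + c ^ 2 - 2 := by
  have hdet {M : Matrix (Fin 2) (Fin 2) ℂ}
      (hM : M ∈ Matrix.specialUnitaryGroup (Fin 2) ℂ) : M.det = 1 :=
    (mem_specialUnitaryGroup_iff.mp hM).2
  rw [sq_eq_trace_smul_sub_one (hdet hA), sq_eq_trace_smul_sub_one (hdet hB),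
    sq_eq_trace_smul_sub_one (hdet hC), ← ha, ← hb, ← hc]
  simp only [sub_mul, mul_sub, smul_mul_assoc, mul_smul_comm, one_mul, mul_one, trace_sub,
    trace_smul, smul_eq_mul, trace_one, Fintype.card_fin, trace_mul_comm A C,
    ← ha, ← hb, ← hc, ← hx, ← hy, ← hz, ← hd]
  push_cast
  ring
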